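/- Let P be a posterior-deterministic POMDP (with unique absorbing observable target state ⊤ and unique absorbing observable value-0 state ⊥). Let b be a sub-belief such that S = supp(b) belongs to the domain of a distinguishing maximal SEC f of P. Then Val(b) = Σ_{C ∈ S/≡_{(f,S)}} Val(b|_C), where the sum ranges over the equivalence classes C of the (f,S)-indistinguishability relation on S and b|_C is the restriction of b to C. -/

import Mathlib

open scoped ENNReal BigOperators Classical
open Filter Topology

/-- A partially observable Markov decision process with finite state space `Q`,
finite action space `A` and finite observation space `O`.  `tr q a o q'` is the
probability `T(o, q' | q, a)` of receiving observation `o` and moving to state `q'`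
when taking action `a` in state `q`. -/
structure POMDP (Q A O : Type) [Fintype Q] [Fintype A] [Fintype O] where
  tr : Q → A → O → Q → ℝ≥0∞
  tr_sum_one : ∀ q a, (∑ o : O, ∑ q' : Q, tr q a o q') = 1

/-- An (observation-based) strategy: to each observable history it assigns a
probability distribution on actions. -/
structure Strategy (A O : Type) [Fintype A] where
  act : List (A × O) → A → ℝ≥0∞
  act_sum_one : ∀ h, (∑ a : A, act h a) = 1

/-- Support of a (sub-)belief. -/
noncomputable def beliefSupp {Q : Type} [Fintype Q] (b : Q → ℝ≥0∞) : Finset Q :=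
  Finset.univ.filter fun q => b q ≠ 0

/-- Dirac belief at a state. -/
noncomputable def dirac {Q : Type} (q : Q) : Q → ℝ≥0∞ := fun q' => if q' = q then 1 else 0

/-- Restriction of a (sub-)belief to a set of states. -/
noncomputable def restrictBel {Q : Type} (b : Q → ℝ≥0∞) (C : Finset Q) : Q → ℝ≥0∞ :=
  fun q => if q ∈ C then b q else 0

/-- The sequence of states visited by a history. -/
def statesOf {Q A O : Type} (q0 : Q) (l : List (A × O × Q)) : List Q :=
  q0 :: l.map fun x => x.2.2

/-- The observable projection of a history. -/
def obsOf {Q A O : Type} (l : List (A × O × Q)) : List (A × O) :=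
  l.map fun x => (x.1, x.2.1)

/-- A history hits the target set `Tset` for the first time at its last state. -/
def FirstHit {Q A O : Type} (Tset : Set Q) (q0 : Q) (l : List (A × O × Q)) : Prop :=
  (∃ q ∈ Tset, (statesOf q0 l).getLast? = some q) ∧
    ∀ q' ∈ (statesOf q0 l).dropLast, q' ∉ Tset

/-- The prefix of length `n` of an observable run. -/
def runPrefix {A O : Type} (ρ : ℕ → A × O) (n : ℕ) : List (A × O) :=
  List.ofFn fun i : Fin n => ρ i

namespace POMDP

variable {Q A O : Type} [Fintype Q] [Fintype A] [Fintype O]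

/-- Marginal probability `T(o | q, a)` of receiving observation `o`. -/
noncomputable def trO (P : POMDP Q A O) (q : Q) (a : A) (o : O) : ℝ≥0∞ := ∑ q' : Q, P.tr q a o q'

/-- A POMDP is posterior-deterministic if for every `(q, a, o)` there is at most one
successor state with positive probability. -/
def PostDet (P : POMDP Q A O) : Prop :=
  ∀ q a o q₁ q₂, P.tr q a o q₁ ≠ 0 → P.tr q a o q₂ ≠ 0 → q₁ = q₂

/-- The set of possible successors of `q` under action `a` and observation `o`
(in a posterior-deterministic POMDP, at most a singleton: `δ(q,a,o)`). -/
noncomputable def succs (P : POMDP Q A O) (q : Q) (a : A) (o : O) : Finset Q :=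
  Finset.univ.filter fun q' => P.tr q a o q' ≠ 0

/-- `δ(S, a, o)` on sets of states. -/
noncomputable def stepSet (P : POMDP Q A O) (S : Finset Q) (a : A) (o : O) : Finset Q :=
  S.biUnion fun q => P.succs q a o

/-- `δ*(S, h)` on sets of states along an observable history. -/
noncomputable def stepSetStar (P : POMDP Q A O) : Finset Q → List (A × O) → Finset Q
  | S, [] => S
  | S, (a, o) :: h => P.stepSetStar (P.stepSet S a o) h

/-- `T(o | b, a)`, the probability of observing `o` from (sub-)belief `b` after action `a`. -/
noncomputable def trOBel (P : POMDP Q A O) (b : Q → ℝ≥0∞) (a : A) (o : O) : ℝ≥0∞ :=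
  ∑ q : Q, b q * P.trO q a o

/-- Belief update `b_{a,o}`. -/
noncomputable def belStep (P : POMDP Q A O) (b : Q → ℝ≥0∞) (a : A) (o : O) : Q → ℝ≥0∞ :=
  fun q => (∑ q' : Q, b q' * P.tr q' a o q) / P.trOBel b a o

/-- Iterated belief update `δ*(b, h)` along an observable history. -/
noncomputable def belStepStar (P : POMDP Q A O) : (Q → ℝ≥0∞) → List (A × O) → Q → ℝ≥0∞
  | b, [] => b
  | b, (a, o) :: h => P.belStepStar (P.belStep b a o) h

/-- Probability of the continuation of a history under a strategy:
`runProbAux σ hist q l` is the probability, starting from state `q` after the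
observable history `hist`, that the next steps are exactly `l`. -/
noncomputable def runProbAux (P : POMDP Q A O) (σ : Strategy A O) :
    List (A × O) → Q → List (A × O × Q) → ℝ≥0∞
  | _, _, [] => 1
  | hist, q, (a, o, q') :: rest =>
      σ.act hist a * P.tr q a o q' * P.runProbAux σ (hist ++ [(a, o)]) q' rest

/-- Probability `P_b^σ(Cyl(q0, l))` of the cylinder of a history. -/
noncomputable def histProb (P : POMDP Q A O) (b : Q → ℝ≥0∞) (σ : Strategy A O)
    (q0 : Q) (l : List (A × O × Q)) : ℝ≥0∞ :=
  b q0 * P.runProbAux σ [] q0 l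

/-- Probability `P_b^σ(Reach(Tset))` of eventually visiting the target set:
the sum of cylinder probabilities over all histories hitting `Tset` for the first
time at their last state. -/
noncomputable def reachProb (P : POMDP Q A O) (Tset : Set Q) (b : Q → ℝ≥0∞)
    (σ : Strategy A O) : ℝ≥0∞ :=
  ∑' p : Q × List (A × O × Q), if FirstHit Tset p.1 p.2 then P.histProb b σ p.1 p.2 else 0

/-- The reachability value `Val(b) = sup_σ P_b^σ(Reach(Tset))`. -/
noncomputable def val (P : POMDP Q A O) (Tset : Set Q) (b : Q → ℝ≥0∞) : ℝ≥0∞ :=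
  ⨆ σ : Strategy A O, P.reachProb Tset b σ

/-- `Val(b, a) = Σ_o T(o | b, a) · Val(b_{a,o})`. -/
noncomputable def valAct (P : POMDP Q A O) (Tset : Set Q) (b : Q → ℝ≥0∞) (a : A) : ℝ≥0∞ :=
  ∑ o : O, P.trOBel b a o * P.val Tset (P.belStep b a o)

/-- A state is absorbing if once reached the system stays there forever. -/
def Absorbing (P : POMDP Q A O) (q : Q) : Prop :=
  ∀ a o q', P.tr q a o q' ≠ 0 → q' = q

/-- A state is observable if there is an observation received exactly when
entering this state. -/
def Observable (P : POMDP Q A O) (q : Q) : Prop :=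
  ∃ o : O, ∀ p a o' q', P.tr p a o' q' ≠ 0 → (q' = q ↔ o' = o)

/-- An observable history is inside a partial function `(dom, act)` from a support
`S`: every action taken is prescribed by `act` at the current support, which stays
in `dom`. -/
def InsideFrom (P : POMDP Q A O) (dom : Set (Finset Q)) (act : Finset Q → Finset A) :
    Finset Q → List (A × O) → Prop
  | _, [] => True
  | S, (a, o) :: h => S ∈ dom ∧ a ∈ act S ∧ InsideFrom P dom act (P.stepSet S a o) h

/-- A support end component (SEC): a partial function from nonempty belief supports
to nonempty sets of actions, closed under prescribed transitions and strongly
connected via prescribed histories. -/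
structure SEC (P : POMDP Q A O) where
  dom : Set (Finset Q)
  act : Finset Q → Finset A
  dom_nonempty : ∀ S ∈ dom, S.Nonempty
  act_nonempty : ∀ S ∈ dom, (act S).Nonempty
  closed : ∀ S ∈ dom, ∀ a ∈ act S, ∀ o : O, (P.stepSet S a o).Nonempty → P.stepSet S a o ∈ dom
  connected : ∀ S ∈ dom, ∀ S' ∈ dom,
      ∃ h : List (A × O), InsideFrom P dom act S h ∧ P.stepSetStar S h = S'

/-- `f` is contained in `f'`. -/
def SEC.Contained {P : POMDP Q A O} (f f' : SEC P) : Prop :=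
  f.dom ⊆ f'.dom ∧ ∀ S ∈ f.dom, f.act S ⊆ f'.act S

/-- A maximal SEC: any SEC containing it coincides with it. -/
def SEC.Maximal {P : POMDP Q A O} (f : SEC P) : Prop :=
  ∀ f' : SEC P, f.Contained f' → f'.dom = f.dom ∧ ∀ S ∈ f.dom, f'.act S = f.act S

/-- `(f, S)`-indistinguishability of two states `q, q' ∈ S`: along every history
inside `f` from `S`, the observation distributions from the (unique) successors of
`q` and `q'` agree for all prescribed actions. -/
def Indist (P : POMDP Q A O) (f : SEC P) (S : Finset Q) (q q' : Q) : Prop :=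
  ∀ h : List (A × O), InsideFrom P f.dom f.act S h →
    ∀ a ∈ f.act (P.stepSetStar S h), ∀ o : O,
      ∀ x ∈ P.stepSetStar {q} h, ∀ y ∈ P.stepSetStar {q'} h,
        P.trO x a o = P.trO y a o

/-- A distinguishing SEC. -/
def SEC.Distinguishing {P : POMDP Q A O} (f : SEC P) : Prop :=
  ∃ S ∈ f.dom, ∃ q ∈ S, ∃ q' ∈ S, ¬ Indist P f S q q'

/-- A non-distinguishing SEC. -/
def SEC.NonDistinguishing {P : POMDP Q A O} (f : SEC P) : Prop :=
  ∀ S ∈ f.dom, ∀ q ∈ S, ∀ q' ∈ S, Indist P f S q q'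

/-- The `(f,S)`-indistinguishability class of `q` inside `S`. -/
noncomputable def classOf (P : POMDP Q A O) (f : SEC P) (S : Finset Q) (q : Q) : Finset Q :=
  S.filter fun q' => Indist P f S q q'

/-- `Reach_f(b)`: the set of beliefs reachable from `b` by histories inside `f`. -/
def reachBel (P : POMDP Q A O) (f : SEC P) (b : Q → ℝ≥0∞) : Set (Q → ℝ≥0∞) :=
  {b' | ∃ h : List (A × O), InsideFrom P f.dom f.act (beliefSupp b) h ∧ P.belStepStar b h = b'}

/-- An observable run stays inside `f` from the support `S0`. -/
def RunInside (P : POMDP Q A O) (f : SEC P) (S0 : Finset Q) (ρ : ℕ → A × O) : Prop :=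
  ∀ n : ℕ, InsideFrom P f.dom f.act S0 (runPrefix ρ n)

/-- The a-posteriori probability `X_q^n(ρ) = δ*(b, ρ|_n)(δ*(q, ρ|_n))` of having
started in `q`, given the first `n` action-observation pairs of `ρ`. -/
noncomputable def Xpost (P : POMDP Q A O) (b : Q → ℝ≥0∞) (q : Q) (ρ : ℕ → A × O)
    (n : ℕ) : ℝ≥0∞ :=
  ∑ x ∈ P.stepSetStar {q} (runPrefix ρ n), P.belStepStar b (runPrefix ρ n) x

/-- A history `h = h' ++ [(a,o)]` distinguishes `q` and `q'`:
`T(o | δ*(q,h'), a) ≠ T(o | δ*(q',h'), a)`. -/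
def HistDistinguishes (P : POMDP Q A O) (q q' : Q) (h : List (A × O)) : Prop :=
  ∃ (h' : List (A × O)) (ao : A × O), h = h' ++ [ao] ∧
    (∑ x ∈ P.stepSetStar {q} h', P.trO x ao.1 ao.2) ≠
      (∑ x ∈ P.stepSetStar {q'} h', P.trO x ao.1 ao.2)

/-- The number of (nonempty) prefixes of `h` distinguishing `q` and `q'`. -/
noncomputable def distCount (P : POMDP Q A O) (q q' : Q) (h : List (A × O)) : ℕ :=
  ((Finset.range (h.length + 1)).filter fun i => P.HistDistinguishes q q' (h.take i)).card

/-- Probability `P_b^σ(Cyl(h))` of the cylinder of an observable history. -/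
noncomputable def obsCylProb (P : POMDP Q A O) (b : Q → ℝ≥0∞) (σ : Strategy A O)
    (h : List (A × O)) : ℝ≥0∞ :=
  ∑' p : Q × List (A × O × Q), if obsOf p.2 = h then P.histProb b σ p.1 p.2 else 0

/-- Probability `P_b^σ(initial state is q ∧ Cyl(h))`. -/
noncomputable def jointProb (P : POMDP Q A O) (b : Q → ℝ≥0∞) (σ : Strategy A O)
    (q : Q) (h : List (A × O)) : ℝ≥0∞ :=
  ∑' l : List (A × O × Q), if obsOf l = h then P.histProb b σ q l else 0

/-- `X_q^n` evaluated on the `F_n`-atom of the observable history `h`: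
the conditional probability of having started in `q` given `Cyl(h)`. -/
noncomputable def condX (P : POMDP Q A O) (b : Q → ℝ≥0∞) (σ : Strategy A O)
    (q : Q) (h : List (A × O)) : ℝ≥0∞ :=
  P.jointProb b σ q h / P.obsCylProb b σ h

/-- Probability `P_b^σ(∃ prefix whose observable history satisfies E)`: the sum of
cylinder probabilities over histories satisfying `E` for the first time. -/
noncomputable def eventProb (P : POMDP Q A O) (b : Q → ℝ≥0∞) (σ : Strategy A O)
    (E : List (A × O) → Prop) : ℝ≥0∞ :=
  ∑' p : Q × List (A × O × Q),
    if E (obsOf p.2) ∧ ∀ l' : List (A × O × Q), l' <+: p.2 → l' ≠ p.2 → ¬ E (obsOf l')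
    then P.histProb b σ p.1 p.2 else 0

/-- The set of actions used by the uniform strategy of an SEC `f` after an
observable history (the prescribed actions if the current support has some,
all actions otherwise). -/
noncomputable def unifSupport (P : POMDP Q A O) (f : SEC P) (S0 : Finset Q)
    (h : List (A × O)) : Finset A :=
  if (f.act (P.stepSetStar S0 h)).Nonempty then f.act (P.stepSetStar S0 h) else Finset.univ

theorem unifSupport_nonempty [Nonempty A] (P : POMDP Q A O) (f : SEC P) (S0 : Finset Q)
    (h : List (A × O)) : (P.unifSupport f S0 h).Nonempty := by
  unfold unifSupport
  split
  · assumption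
  · exact Finset.univ_nonempty

/-- The uniform strategy `unif_f`: it tracks the current belief support and picks a
prescribed action uniformly at random. -/
noncomputable def unifStrat [Nonempty A] (P : POMDP Q A O) (f : SEC P) (S0 : Finset Q) :
    Strategy A O where
  act h a := if a ∈ P.unifSupport f S0 h then ((P.unifSupport f S0 h).card : ℝ≥0∞)⁻¹ else 0
  act_sum_one := by
    intro h
    have hne := P.unifSupport_nonempty f S0 h
    rw [Finset.sum_ite_mem, Finset.univ_inter, Finset.sum_const, nsmul_eq_mul,
      ENNReal.mul_inv_cancel]
    · exact Nat.cast_ne_zero.mpr (Finset.card_ne_zero.mpr hne)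
    · exact ENNReal.natCast_ne_top _

end POMDP

namespace POMDP

variable {Q A O : Type} [Fintype Q] [Fintype A] [Fintype O]

theorem tsum_list_cons {X : Type} (g : List X → ℝ≥0∞) :
    ∑' l, g l = g [] + ∑' x, ∑' l, g (x :: l) := by
  let e : Unit ⊕ (X × List X) ≃ List X :=
    { toFun := fun s => Sum.elim (fun _ => []) (fun p => p.1 :: p.2) s
      invFun := fun l => match l with
        | [] => Sum.inl ()
        | x :: l => Sum.inr (x, l)
      left_inv := by rintro (_ | _) <;> rfl
      right_inv := by rintro (_ | _) <;> rfl }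
  rw [← e.tsum_eq g, ENNReal.summable.tsum_sum (by exact ENNReal.summable), ENNReal.tsum_prod']
  simp [e]

theorem firstHit_nil (top q : Q) :
    FirstHit (A := A) (O := O) {top} q [] ↔ q = top := by
  simp [FirstHit, statesOf]

theorem firstHit_cons (top q : Q) (x : A × O × Q) (l : List (A × O × Q)) :
    FirstHit {top} q (x :: l) ↔ q ≠ top ∧ FirstHit {top} x.2.2 l := by
  have h1 : statesOf q (x :: l) = q :: statesOf x.2.2 l := rfl
  have h2 : ∃ y s, statesOf x.2.2 l = y :: s := ⟨_, _, rfl⟩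
  obtain ⟨y, s, h2⟩ := h2
  unfold FirstHit
  rw [h1, h2, List.getLast?_cons_cons, List.dropLast_cons_cons]
  simp only [List.mem_cons, forall_eq_or_imp, Set.mem_singleton_iff]
  tauto

/-- probability of reaching `top` from `q` after history `hist`. -/
noncomputable def rho (P : POMDP Q A O) (top : Q) (σ : Strategy A O) (hist : List (A × O))
    (q : Q) : ℝ≥0∞ :=
  ∑' l : List (A × O × Q), if FirstHit {top} q l then P.runProbAux σ hist q l else 0

theorem reachProb_eq (P : POMDP Q A O) (top : Q) (σ : Strategy A O) (b : Q → ℝ≥0∞) :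
    P.reachProb {top} b σ = ∑ q, b q * P.rho top σ [] q := by
  unfold reachProb
  rw [ENNReal.tsum_prod', tsum_fintype]
  refine Finset.sum_congr rfl fun q _ => ?_
  unfold rho histProb
  rw [← ENNReal.tsum_mul_left]
  refine tsum_congr fun l => ?_
  simp only [mul_ite, mul_zero]

theorem rho_top (P : POMDP Q A O) (top : Q) (σ : Strategy A O) (hist : List (A × O)) :
    P.rho top σ hist top = 1 := by
  unfold rho
  rw [tsum_list_cons]
  simp [firstHit_nil, firstHit_cons, runProbAux]

theorem rho_rec (P : POMDP Q A O) (top : Q) (σ : Strategy A O) (hist : List (A × O)) (q : Q)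
    (hq : q ≠ top) :
    P.rho top σ hist q = ∑ a, ∑ o, ∑ q', σ.act hist a * P.tr q a o q' *
      P.rho top σ (hist ++ [(a, o)]) q' := by
  conv_lhs => unfold rho
  rw [tsum_list_cons, tsum_fintype, Fintype.sum_prod_type]
  simp only [firstHit_nil, hq, if_false, zero_add, Fintype.sum_prod_type]
  refine Finset.sum_congr rfl fun a _ => Finset.sum_congr rfl fun o _ =>
    Finset.sum_congr rfl fun q' _ => ?_
  unfold rho
  rw [← ENNReal.tsum_mul_left]
  refine tsum_congr fun l => ?_
  simp [firstHit_cons, hq, runProbAux]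

theorem rho_le_one_aux (P : POMDP Q A O) (top : Q) (σ : Strategy A O) (n : ℕ) :
    ∀ (hist : List (A × O)) (q : Q),
    ∑' l : List (A × O × Q), (if FirstHit {top} q l ∧ l.length ≤ n then
      P.runProbAux σ hist q l else 0) ≤ 1 := by
  induction n with
  | zero =>
    intro hist q
    rw [tsum_list_cons]
    simp only [List.length_cons]
    simp [runProbAux]
    split_ifs <;> simp
  | succ n ih =>
    intro hist q
    rw [tsum_list_cons]
    by_cases hq : q = top
    · subst hq
      simp [firstHit_nil, firstHit_cons, runProbAux]
    · simp only [firstHit_nil, hq, false_and, if_false, zero_add]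
      rw [tsum_fintype, Fintype.sum_prod_type]
      simp only [Fintype.sum_prod_type]
      calc _ ≤ ∑ a, ∑ o, ∑ q', σ.act hist a * P.tr q a o q' * 1 := by
            refine Finset.sum_le_sum fun a _ => Finset.sum_le_sum fun o _ =>
              Finset.sum_le_sum fun q' _ => ?_
            refine le_trans ?_ (mul_le_mul_right (ih (hist ++ [(a, o)]) q') _)
            rw [← ENNReal.tsum_mul_left]
            refine ENNReal.tsum_le_tsum fun l => ?_
            simp [firstHit_cons, hq, runProbAux]
        _ = 1 := by
            simp only [mul_one, ← Finset.mul_sum, P.tr_sum_one, σ.act_sum_one]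

theorem rho_le_one (P : POMDP Q A O) (top : Q) (σ : Strategy A O) (hist : List (A × O)) (q : Q) :
    P.rho top σ hist q ≤ 1 := by
  unfold rho
  rw [ENNReal.tsum_eq_iSup_sum]
  refine iSup_le fun s => ?_
  refine le_trans ?_ (P.rho_le_one_aux top σ (s.sup List.length) hist q)
  refine le_trans (Finset.sum_le_sum ?_) (ENNReal.sum_le_tsum s)
  intro l hl
  have := Finset.le_sup (f := List.length) hl
  by_cases h : FirstHit {top} q l <;> simp [h, this]

theorem val_le (P : POMDP Q A O) (top : Q) (b : Q → ℝ≥0∞) : P.val {top} b ≤ ∑ q, b q := by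
  refine iSup_le fun σ => ?_
  rw [reachProb_eq]
  refine Finset.sum_le_sum fun q _ => ?_
  exact mul_le_of_le_one_right' (P.rho_le_one top σ [] q)

theorem val_mono (P : POMDP Q A O) (top : Q) (b b' : Q → ℝ≥0∞) (h : ∀ q, b q ≤ b' q) :
    P.val {top} b ≤ P.val {top} b' := by
  refine iSup_mono fun σ => ?_
  rw [reachProb_eq, reachProb_eq]
  exact Finset.sum_le_sum fun q _ => mul_le_mul_left (h q) _

theorem val_smul (P : POMDP Q A O) (top : Q) (b : Q → ℝ≥0∞) (c : ℝ≥0∞) :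
    P.val {top} (fun q => c * b q) = c * P.val {top} b := by
  unfold val
  rw [ENNReal.mul_iSup]
  refine iSup_congr fun σ => ?_
  rw [reachProb_eq, reachProb_eq, Finset.mul_sum]
  exact Finset.sum_congr rfl fun q _ => mul_assoc _ _ _

/-- First play `a`, then, upon observing `o`, follow `τ o`. -/
noncomputable def consStrat (a : A) (τ : O → Strategy A O) : Strategy A O where
  act h a' := match h with
    | [] => if a' = a then 1 else 0
    | (_, o) :: h => (τ o).act h a'
  act_sum_one := by
    rintro (_ | ⟨⟨a', o⟩, h⟩)
    · simp
    · exact (τ o).act_sum_one h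

theorem runProbAux_cons (P : POMDP Q A O) (a a' : A) (o : O) (τ : O → Strategy A O)
    (l : List (A × O × Q)) : ∀ (h : List (A × O)) (q : Q),
    P.runProbAux (consStrat a τ) ((a', o) :: h) q l = P.runProbAux (τ o) h q l := by
  induction l with
  | nil => intro h q; rfl
  | cons x l ih =>
    obtain ⟨a2, o2, q2⟩ := x
    intro h q
    simp only [runProbAux, List.cons_append, ih]
    rfl

theorem rho_cons (P : POMDP Q A O) (top : Q) (htop : P.Absorbing top)
    (a : A) (τ : O → Strategy A O) (q : Q) :
    P.rho top (consStrat a τ) [] q = ∑ o, ∑ q', P.tr q a o q' * P.rho top (τ o) [] q' := by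
  by_cases hq : q = top
  · subst hq
    rw [rho_top, ← P.tr_sum_one q a]
    refine Finset.sum_congr rfl fun o _ => Finset.sum_congr rfl fun q' _ => ?_
    by_cases h : P.tr q a o q' = 0
    · simp [h]
    · rw [htop _ _ _ h, rho_top, mul_one]
  · rw [rho_rec _ _ _ _ _ hq]
    rw [Finset.sum_eq_single a]
    · refine Finset.sum_congr rfl fun o _ => Finset.sum_congr rfl fun q' _ => ?_
      have : (consStrat a τ).act [] a = 1 := by simp [consStrat]
      rw [this, one_mul]
      congr 1
      unfold rho
      simp only [List.nil_append, runProbAux_cons]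
    · intro a' _ ha
      have : (consStrat a τ).act [] a' = 0 := by simp [consStrat, ha]
      simp [this]
    · simp

/-- unnormalised update -/
noncomputable def upd (P : POMDP Q A O) (b : Q → ℝ≥0∞) (a : A) (o : O) : Q → ℝ≥0∞ :=
  fun q' => ∑ q, b q * P.tr q a o q'

theorem val_super (P : POMDP Q A O) (top : Q) (htop : P.Absorbing top) (b : Q → ℝ≥0∞)
    (hb : ∑ q, b q ≠ ⊤) (a : A) :
    ∑ o, P.val {top} (P.upd b a o) ≤ P.val {top} b := by
  have hfin : ∀ o, P.val {top} (P.upd b a o) ≠ ⊤ := by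
    intro o
    refine ne_top_of_le_ne_top hb ((P.val_le top _).trans ?_)
    unfold upd
    rw [Finset.sum_comm]
    refine Finset.sum_le_sum fun q _ => ?_
    rw [← Finset.mul_sum]
    refine mul_le_of_le_one_right' ?_
    rw [← P.tr_sum_one q a]
    exact Finset.single_le_sum (f := fun o => ∑ q', P.tr q a o q') (fun _ _ => zero_le)
      (Finset.mem_univ o)
  have key : ∀ τ : O → Strategy A O,
      ∑ o, P.reachProb {top} (P.upd b a o) (τ o) ≤ P.val {top} b := by
    intro τ
    refine le_trans (le_of_eq ?_) (le_iSup _ (consStrat a τ))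
    rw [reachProb_eq]
    simp only [rho_cons P top htop, reachProb_eq, upd, Finset.sum_mul, Finset.mul_sum]
    conv_rhs => rw [Finset.sum_comm]
    refine Finset.sum_congr rfl fun o _ => ?_
    rw [Finset.sum_comm]
    simp only [mul_assoc]
  refine ENNReal.le_of_forall_pos_le_add fun ε hε _ => ?_
  have hne : (Fintype.card O : ℝ≥0∞) ≠ ⊤ := ENNReal.natCast_ne_top _
  have hex : ∀ o, ∃ τ : Strategy A O, P.val {top} (P.upd b a o) ≤
      P.reachProb {top} (P.upd b a o) τ + (ε : ℝ≥0∞) / Fintype.card O := by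
    intro o
    by_contra hcon
    push Not at hcon
    have hpos : (ε : ℝ≥0∞) / Fintype.card O ≠ 0 := by
      simp [ENNReal.div_eq_zero_iff, hε.ne', hne]
    have : Nonempty (Strategy A O) := ⟨⟨fun _ a' => if a' = a then 1 else 0, by simp⟩⟩
    have h1 : P.val {top} (P.upd b a o) + (ε : ℝ≥0∞) / Fintype.card O ≤
        P.val {top} (P.upd b a o) := by
      conv_lhs => unfold val
      rw [ENNReal.iSup_add]
      exact iSup_le fun τ => (hcon τ).le
    exact absurd h1 (not_le.mpr (ENNReal.lt_add_right (hfin o) hpos))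
  choose τ hτ using hex
  refine (Finset.sum_le_sum fun o _ => hτ o).trans ?_
  rw [Finset.sum_add_distrib]
  refine add_le_add (key τ) ?_
  simp only [Finset.sum_const, Finset.card_univ, nsmul_eq_mul]
  exact ENNReal.mul_div_le

end POMDP

namespace POMDP

variable {Q A O : Type} [Fintype Q] [Fintype A] [Fintype O]

/-- the (total) successor function -/
noncomputable def del (P : POMDP Q A O) (a : A) (o : O) (q : Q) : Q :=
  if h : (P.succs q a o).Nonempty then h.choose else q

theorem succs_eq_empty_iff (P : POMDP Q A O) (q : Q) (a : A) (o : O) :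
    P.succs q a o = ∅ ↔ P.trO q a o = 0 := by
  simp [succs, trO, Finset.filter_eq_empty_iff]

theorem succs_eq (P : POMDP Q A O) (hP : P.PostDet) (q : Q) (a : A) (o : O)
    (h : P.trO q a o ≠ 0) : P.succs q a o = {P.del a o q} := by
  have hne : (P.succs q a o).Nonempty := by
    rw [Finset.nonempty_iff_ne_empty]
    exact fun h' => h ((P.succs_eq_empty_iff q a o).1 h')
  have hd : P.del a o q ∈ P.succs q a o := by
    unfold del
    rw [dif_pos hne]
    exact hne.choose_spec
  refine Finset.eq_singleton_iff_unique_mem.2 ⟨hd, fun x hx => ?_⟩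
  simp only [succs, Finset.mem_filter, Finset.mem_univ, true_and] at hd hx
  exact hP _ _ _ _ _ hx hd

theorem tr_eq (P : POMDP Q A O) (hP : P.PostDet) (q : Q) (a : A) (o : O) (q' : Q) :
    P.tr q a o q' = if P.del a o q = q' then P.trO q a o else 0 := by
  by_cases h : P.trO q a o = 0
  · have : ∀ x, P.tr q a o x = 0 := by simpa [trO] using h
    simp [this, h]
  · have hs := P.succs_eq hP q a o h
    have hz : ∀ x, x ≠ P.del a o q → P.tr q a o x = 0 := by
      intro x hx
      by_contra hc
      have : x ∈ P.succs q a o := by simp [succs, hc]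
      rw [hs, Finset.mem_singleton] at this
      exact hx this
    split_ifs with hq
    · subst hq
      unfold trO
      rw [Finset.sum_eq_single (P.del a o q)]
      · intro x _ hx
        exact hz x hx
      · simp
    · exact hz _ (Ne.symm hq)

/-- iterated successor function -/
noncomputable def dstar (P : POMDP Q A O) : List (A × O) → Q → Q
  | [], q => q
  | (a, o) :: h, q => P.dstar h (P.del a o q)

theorem dstar_append (P : POMDP Q A O) (h h' : List (A × O)) (q : Q) :
    P.dstar (h ++ h') q = P.dstar h' (P.dstar h q) := by
  induction h generalizing q with
  | nil => rfl
  | cons x h ih => exact ih _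

theorem stepSetStar_append (P : POMDP Q A O) (h h' : List (A × O)) (S : Finset Q) :
    P.stepSetStar S (h ++ h') = P.stepSetStar (P.stepSetStar S h) h' := by
  induction h generalizing S with
  | nil => rfl
  | cons x h ih => exact ih _

theorem insideFrom_append (P : POMDP Q A O) (dom : Set (Finset Q)) (act : Finset Q → Finset A)
    (h h' : List (A × O)) (S : Finset Q) (h1 : InsideFrom P dom act S h)
    (h2 : InsideFrom P dom act (P.stepSetStar S h) h') : InsideFrom P dom act S (h ++ h') := by
  induction h generalizing S with
  | nil => exact h2
  | cons x h ih => exact ⟨h1.1, h1.2.1, ih _ h1.2.2 h2⟩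

theorem stepSet_mono (P : POMDP Q A O) (S S' : Finset Q) (h : S ⊆ S') (a : A) (o : O) :
    P.stepSet S a o ⊆ P.stepSet S' a o :=
  Finset.biUnion_subset_biUnion_of_subset_left _ h

theorem stepSetStar_mono (P : POMDP Q A O) (h : List (A × O)) (S S' : Finset Q) (hs : S ⊆ S') :
    P.stepSetStar S h ⊆ P.stepSetStar S' h := by
  induction h generalizing S S' with
  | nil => exact hs
  | cons x h ih => exact ih _ _ (P.stepSet_mono _ _ hs _ _)

theorem stepSetStar_empty (P : POMDP Q A O) (h : List (A × O)) : P.stepSetStar ∅ h = ∅ := by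
  induction h with
  | nil => rfl
  | cons x h ih => simpa [stepSetStar, stepSet] using ih

theorem stepSet_eq (P : POMDP Q A O) (hP : P.PostDet) (S : Finset Q) (a : A) (o : O) :
    P.stepSet S a o = (S.filter fun q => P.trO q a o ≠ 0).image (P.del a o) := by
  ext x
  simp only [stepSet, Finset.mem_biUnion, Finset.mem_image, Finset.mem_filter]
  constructor
  · rintro ⟨q, hq, hx⟩
    have h : P.trO q a o ≠ 0 := by
      intro h
      rw [(P.succs_eq_empty_iff q a o).2 h] at hx
      simp at hx
    rw [P.succs_eq hP q a o h, Finset.mem_singleton] at hx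
    exact ⟨q, ⟨hq, h⟩, hx.symm⟩
  · rintro ⟨q, ⟨hq, h⟩, hx⟩
    exact ⟨q, hq, by rw [P.succs_eq hP q a o h, hx]; simp⟩

theorem card_stepSet_le (P : POMDP Q A O) (hP : P.PostDet) (S : Finset Q) (a : A) (o : O) :
    (P.stepSet S a o).card ≤ S.card := by
  rw [P.stepSet_eq hP]
  exact Finset.card_image_le.trans (Finset.card_filter_le _ _)

theorem card_stepSetStar_le (P : POMDP Q A O) (hP : P.PostDet) (S : Finset Q)
    (h : List (A × O)) : (P.stepSetStar S h).card ≤ S.card := by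
  induction h generalizing S with
  | nil => exact le_rfl
  | cons x h ih => exact (ih _).trans (P.card_stepSet_le hP _ _ _)

variable {P : POMDP Q A O}

theorem step_facts (hP : P.PostDet) (f : SEC P) (S : Finset Q) (hS : S ∈ f.dom) (a : A)
    (ha : a ∈ f.act S) (o : O) (hne : (P.stepSet S a o).Nonempty) :
    (∀ q ∈ S, P.trO q a o ≠ 0) ∧ Set.InjOn (P.del a o) S ∧
      P.stepSet S a o = S.image (P.del a o) := by
  obtain ⟨h, -, hh⟩ := f.connected _ (f.closed S hS a ha o hne) S hS
  have h1 : S.card ≤ (P.stepSet S a o).card := by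
    conv_lhs => rw [← hh]
    exact P.card_stepSetStar_le hP _ _
  rw [P.stepSet_eq hP] at h1 ⊢
  have h2 : (S.filter fun q => P.trO q a o ≠ 0) = S :=
    Finset.eq_of_subset_of_card_le (Finset.filter_subset _ _) (h1.trans Finset.card_image_le)
  rw [h2] at h1 ⊢
  refine ⟨Finset.filter_eq_self.1 h2, ?_, rfl⟩
  exact Finset.card_image_iff.1 (le_antisymm Finset.card_image_le h1)

/-- A realisable history inside `f` from `S`. -/
def Good (f : SEC P) (S : Finset Q) (h : List (A × O)) : Prop :=
  InsideFrom P f.dom f.act S h ∧ (P.stepSetStar S h).Nonempty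

theorem good_spec (hP : P.PostDet) (f : SEC P) (h : List (A × O)) :
    ∀ (S : Finset Q), S ∈ f.dom → Good f S h →
    P.stepSetStar S h ∈ f.dom ∧ P.stepSetStar S h = S.image (P.dstar h) ∧
      Set.InjOn (P.dstar h) S ∧ ∀ q ∈ S, P.stepSetStar {q} h = {P.dstar h q} := by
  induction h with
  | nil =>
    intro S hS hg
    refine ⟨hS, ?_, ?_, fun q _ => rfl⟩
    · simp [stepSetStar, dstar]
    · intro x _ y _ hxy
      exact hxy
  | cons x h ih =>
    obtain ⟨a, o⟩ := x
    intro S hS hg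
    have hne : (P.stepSet S a o).Nonempty := by
      rw [Finset.nonempty_iff_ne_empty]
      intro he
      have := hg.2
      simp [stepSetStar, he, stepSetStar_empty] at this
    obtain ⟨h1, h2, h3⟩ := step_facts hP f S hS a hg.1.2.1 o hne
    obtain ⟨i1, i2, i3, i4⟩ := ih _ (f.closed S hS a hg.1.2.1 o hne) ⟨hg.1.2.2, hg.2⟩
    refine ⟨i1, ?_, ?_, ?_⟩
    · change P.stepSetStar (P.stepSet S a o) h = _
      rw [i2, h3, Finset.image_image]
      rfl
    · intro x hx y hy hxy
      have e : ∀ z ∈ S, P.del a o z ∈ (P.stepSet S a o) := by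
        intro z hz
        rw [h3]
        exact Finset.mem_image_of_mem _ hz
      exact h2 hx hy (i3 (e x hx) (e y hy) hxy)
    · intro q hq
      change P.stepSetStar (P.stepSet {q} a o) h = _
      have : P.stepSet {q} a o = {P.del a o q} := by
        simp [stepSet, P.succs_eq hP q a o (h1 q hq)]
      rw [this]
      apply i4
      rw [h3]
      exact Finset.mem_image_of_mem _ hq

theorem good_nil (f : SEC P) (S : Finset Q) (hS : S ∈ f.dom) : Good f S [] :=
  ⟨trivial, f.dom_nonempty S hS⟩

theorem good_append (f : SEC P) (S : Finset Q) (h h' : List (A × O)) (h1 : Good f S h)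
    (h2 : Good f (P.stepSetStar S h) h') : Good f S (h ++ h') :=
  ⟨P.insideFrom_append _ _ _ _ _ h1.1 h2.1, by rw [stepSetStar_append]; exact h2.2⟩

theorem good_snoc (hP : P.PostDet) (f : SEC P) (S : Finset Q) (hS : S ∈ f.dom)
    (h : List (A × O)) (hg : Good f S h)
    (a : A) (ha : a ∈ f.act (P.stepSetStar S h)) (o : O)
    (hne : (P.stepSet (P.stepSetStar S h) a o).Nonempty) : Good f S (h ++ [(a, o)]) :=
  good_append f S h _ hg ⟨⟨(good_spec hP f h S hS hg).1, ha, trivial⟩, hne⟩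

/-- Induction along extensions of a good history. -/
theorem good_ext_induct (hP : P.PostDet) (f : SEC P) (S : Finset Q) (hS : S ∈ f.dom)
    (R : List (A × O) → Prop) (h0 : List (A × O)) (hg : Good f S h0) (hR : R h0)
    (hstep : ∀ h, Good f S h → R h → ∀ a ∈ f.act (P.stepSetStar S h), ∀ o,
      (P.stepSet (P.stepSetStar S h) a o).Nonempty → R (h ++ [(a, o)])) :
    ∀ h', Good f (P.stepSetStar S h0) h' → R (h0 ++ h') := by
  intro h'
  induction h' generalizing h0 with
  | nil => intro _; simpa using hR
  | cons x h' ih =>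
    obtain ⟨a, o⟩ := x
    intro hg'
    have hne : (P.stepSet (P.stepSetStar S h0) a o).Nonempty := by
      rw [Finset.nonempty_iff_ne_empty]
      intro he
      have := hg'.2
      simp [stepSetStar, he, stepSetStar_empty] at this
    have := ih (h0 ++ [(a, o)]) (good_snoc hP f S hS h0 hg a hg'.1.2.1 o hne)
      (hstep h0 hg hR a hg'.1.2.1 o hne) (by
        rw [stepSetStar_append]
        exact ⟨hg'.1.2.2, hg'.2⟩)
    simpa using this

theorem good_loop (hP : P.PostDet) (f : SEC P) (S : Finset Q) (hS : S ∈ f.dom)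
    (h : List (A × O)) (hg : Good f S h) (hl : P.stepSetStar S h = S) :
    ∃ h', Good f S h' ∧ P.stepSetStar S h' = S ∧ ∀ q ∈ S, P.dstar h' (P.dstar h q) = q := by
  obtain ⟨-, h2, h3, -⟩ := good_spec hP f h S hS hg
  rw [hl] at h2
  have hmaps : ∀ n, ∃ h', Good f S h' ∧ P.stepSetStar S h' = S ∧
      ∀ q, P.dstar h' q = (P.dstar h)^[n] q := by
    intro n
    induction n with
    | zero => exact ⟨[], good_nil f S hS, rfl, fun q => rfl⟩
    | succ n ih =>
      obtain ⟨k, k1, k2, k3⟩ := ih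
      refine ⟨h ++ k, good_append f S h k hg (by rw [hl]; exact k1), ?_, ?_⟩
      · rw [stepSetStar_append, hl, k2]
      · intro q
        rw [dstar_append, k3]
        rfl
  have hto : ∀ q ∈ S, P.dstar h q ∈ S := by
    intro q hq
    rw [h2]
    exact Finset.mem_image_of_mem _ hq
  let g : S → S := fun q => ⟨P.dstar h q, hto q q.2⟩
  have hginj : Function.Injective g := by
    intro x y hxy
    exact Subtype.ext (h3 x.2 y.2 (congrArg Subtype.val hxy))
  let e : Equiv.Perm S := Equiv.ofBijective g (Finite.injective_iff_bijective.1 hginj)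
  have hpow : ∀ n (q : S), (((e ^ n) q : S) : Q) = (P.dstar h)^[n] q := by
    intro n
    induction n with
    | zero => intro q; rfl
    | succ n ih =>
      intro q
      rw [pow_succ, Equiv.Perm.mul_apply, ih]
      rfl
  obtain ⟨k, k1, k2, k3⟩ := hmaps (orderOf e - 1)
  refine ⟨k, k1, k2, fun q hq => ?_⟩
  rw [k3]
  have hpos : 0 < orderOf e := orderOf_pos e
  have := hpow (orderOf e) ⟨q, hq⟩
  rw [pow_orderOf_eq_one] at this
  rw [← Function.iterate_succ_apply, Nat.succ_eq_add_one, Nat.sub_add_cancel hpos]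
  exact this.symm

theorem good_return (hP : P.PostDet) (f : SEC P) (S : Finset Q) (hS : S ∈ f.dom)
    (h : List (A × O)) (hg : Good f S h) :
    ∃ h', Good f (P.stepSetStar S h) h' ∧ P.stepSetStar S (h ++ h') = S ∧
      ∀ q ∈ S, P.dstar (h ++ h') q = q := by
  obtain ⟨k, k1, k2⟩ := f.connected _ (good_spec hP f h S hS hg).1 S hS
  have gk : Good f (P.stepSetStar S h) k := ⟨k1, by rw [k2]; exact f.dom_nonempty S hS⟩
  have ghk := good_append f S h k hg gk
  have hhk : P.stepSetStar S (h ++ k) = S := by rw [stepSetStar_append, k2]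
  obtain ⟨m, m1, m2, m3⟩ := good_loop hP f S hS (h ++ k) ghk hhk
  refine ⟨k ++ m, good_append f _ k m gk (by rw [k2]; exact m1), ?_, ?_⟩
  · rw [← List.append_assoc, stepSetStar_append, hhk, m2]
  · intro q hq
    rw [← List.append_assoc, dstar_append]
    exact m3 q hq

theorem indist_iff (hP : P.PostDet) (f : SEC P) (S : Finset Q) (hS : S ∈ f.dom) (q q' : Q)
    (hq : q ∈ S) (hq' : q' ∈ S) :
    Indist P f S q q' ↔ ∀ h, Good f S h → ∀ a ∈ f.act (P.stepSetStar S h), ∀ o,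
      P.trO (P.dstar h q) a o = P.trO (P.dstar h q') a o := by
  constructor
  · intro H h hg a ha o
    obtain ⟨-, -, -, h4⟩ := good_spec hP f h S hS hg
    exact H h hg.1 a ha o _ (by rw [h4 q hq]; simp) _ (by rw [h4 q' hq']; simp)
  · intro H h hi a ha o x hx y hy
    have hg : Good f S h := ⟨hi, x, P.stepSetStar_mono h {q} S (by simpa using hq) hx⟩
    obtain ⟨-, -, -, h4⟩ := good_spec hP f h S hS hg
    rw [h4 q hq, Finset.mem_singleton] at hx
    rw [h4 q' hq', Finset.mem_singleton] at hy
    rw [hx, hy]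
    exact H h hg a ha o

theorem classOf_eq_iff (hP : P.PostDet) (f : SEC P) (S : Finset Q) (hS : S ∈ f.dom) (q q' : Q)
    (hq : q ∈ S) (hq' : q' ∈ S) :
    classOf P f S q = classOf P f S q' ↔ Indist P f S q q' := by
  constructor
  · intro h
    have : q' ∈ classOf P f S q' := by
      simp only [classOf, Finset.mem_filter]
      refine ⟨hq', (indist_iff hP f S hS _ _ hq' hq').2 fun _ _ _ _ _ => rfl⟩
    rw [← h] at this
    exact (Finset.mem_filter.1 this).2
  · intro h
    rw [indist_iff hP f S hS _ _ hq hq'] at h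
    unfold classOf
    refine Finset.filter_congr fun x hx => ?_
    rw [indist_iff hP f S hS _ _ hq hx, indist_iff hP f S hS _ _ hq' hx]
    constructor
    · intro h2 k hk a ha o
      rw [← h k hk a ha o, h2 k hk a ha o]
    · intro h2 k hk a ha o
      rw [h k hk a ha o, h2 k hk a ha o]

end POMDP

namespace POMDP

variable {Q A O : Type} [Fintype Q] [Fintype A] [Fintype O]

/-- real-valued observation probabilities -/
noncomputable def tt (P : POMDP Q A O) (q : Q) (a : A) (o : O) : ℝ := (P.trO q a o).toReal

theorem sum_trO (P : POMDP Q A O) (q : Q) (a : A) : ∑ o, P.trO q a o = 1 := P.tr_sum_one q a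

theorem trO_ne_top (P : POMDP Q A O) (q : Q) (a : A) (o : O) : P.trO q a o ≠ ⊤ := by
  refine ne_top_of_le_ne_top ENNReal.one_ne_top ?_
  rw [← P.sum_trO q a]
  exact Finset.single_le_sum (f := fun o => P.trO q a o) (fun _ _ => zero_le) (Finset.mem_univ o)

theorem tt_nonneg (P : POMDP Q A O) (q : Q) (a : A) (o : O) : 0 ≤ P.tt q a o :=
  ENNReal.toReal_nonneg

theorem sum_tt (P : POMDP Q A O) (q : Q) (a : A) : ∑ o, P.tt q a o = 1 := by
  unfold tt
  rw [← ENNReal.toReal_sum fun o _ => P.trO_ne_top q a o, P.sum_trO, ENNReal.toReal_one]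

theorem tt_pos (P : POMDP Q A O) (q : Q) (a : A) (o : O) (h : P.trO q a o ≠ 0) :
    0 < P.tt q a o := ENNReal.toReal_pos h (P.trO_ne_top q a o)

/-- real-valued value function -/
noncomputable def W (P : POMDP Q A O) (top : Q) (u : Q → ℝ) : ℝ :=
  (P.val {top} (fun q => ENNReal.ofReal (u q))).toReal

theorem val_ofReal_ne_top (P : POMDP Q A O) (top : Q) (u : Q → ℝ) :
    P.val {top} (fun q => ENNReal.ofReal (u q)) ≠ ⊤ :=
  ne_top_of_le_ne_top (ENNReal.sum_ne_top.2 fun _ _ => ENNReal.ofReal_ne_top) (P.val_le top _)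

theorem W_nonneg (P : POMDP Q A O) (top : Q) (u : Q → ℝ) : 0 ≤ P.W top u :=
  ENNReal.toReal_nonneg

theorem W_mono (P : POMDP Q A O) (top : Q) (u u' : Q → ℝ) (h : ∀ q, u q ≤ u' q) :
    P.W top u ≤ P.W top u' :=
  ENNReal.toReal_mono (P.val_ofReal_ne_top top u')
    (P.val_mono top _ _ fun q => ENNReal.ofReal_le_ofReal (h q))

theorem W_smul (P : POMDP Q A O) (top : Q) (u : Q → ℝ) (c : ℝ) (hc : 0 ≤ c) :
    P.W top (fun q => c * u q) = c * P.W top u := by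
  unfold W
  simp only [ENNReal.ofReal_mul hc]
  rw [P.val_smul, ENNReal.toReal_mul, ENNReal.toReal_ofReal hc]

theorem W_le (P : POMDP Q A O) (top : Q) (u : Q → ℝ) (hu : ∀ q, 0 ≤ u q) :
    P.W top u ≤ ∑ q, u q := by
  unfold W
  have h := P.val_le top (fun q => ENNReal.ofReal (u q))
  rw [← ENNReal.ofReal_sum_of_nonneg fun q _ => hu q] at h
  exact ENNReal.toReal_le_of_le_ofReal (Finset.sum_nonneg fun q _ => hu q) h

/-- push-forward of a weight vector -/
noncomputable def push (π : Q → Q) (u : Q → ℝ) : Q → ℝ :=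
  fun x => ∑ q, if π q = x then u q else 0

theorem push_nonneg (π : Q → Q) (u : Q → ℝ) (hu : ∀ q, 0 ≤ u q) (x : Q) : 0 ≤ push π u x :=
  Finset.sum_nonneg fun q _ => by split_ifs <;> simp [hu q]

theorem push_mono (π : Q → Q) (u u' : Q → ℝ) (hu : ∀ q, u q ≤ u' q) (x : Q) :
    push π u x ≤ push π u' x :=
  Finset.sum_le_sum fun q _ => by split_ifs <;> simp [hu q]

theorem push_smul (π : Q → Q) (u : Q → ℝ) (c : ℝ) :
    push π (fun q => c * u q) = fun x => c * push π u x := by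
  funext x
  simp [push, Finset.mul_sum]

theorem push_push (g π : Q → Q) (u k : Q → ℝ) :
    push g (fun x => push π u x * k x) = push (fun q => g (π q)) (fun q => u q * k (π q)) := by
  funext y
  unfold push
  have : ∀ x, (if g x = y then (∑ q, if π q = x then u q else 0) * k x else 0) =
      ∑ q, if π q = x then (if g (π q) = y then u q * k (π q) else 0) else 0 := by
    intro x
    split_ifs with h
    · rw [Finset.sum_mul]
      refine Finset.sum_congr rfl fun q _ => ?_
      split_ifs with h1 h2 h2
      · rw [h1]
      · rw [h1] at h2; exact absurd h h2
      · simp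
    · symm
      refine Finset.sum_eq_zero fun q _ => ?_
      split_ifs <;> simp_all
  simp only [this]
  rw [Finset.sum_comm]
  simp

theorem push_eq_self (π : Q → Q) (u : Q → ℝ) (h : ∀ q, u q ≠ 0 → π q = q) : push π u = u := by
  funext x
  unfold push
  have : ∀ q, (if π q = x then u q else 0) = if q = x then u q else 0 := by
    intro q
    by_cases hq : u q = 0
    · simp [hq]
    · rw [h q hq]
  simp [this]

theorem push_congr (π : Q → Q) (u u' : Q → ℝ) (h : ∀ q, u q = u' q) : push π u = push π u' := by
  rw [show u = u' from funext h]

variable {P : POMDP Q A O}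

theorem W_super (hP : P.PostDet) (top : Q) (htop : P.Absorbing top) (u : Q → ℝ)
    (hu : ∀ q, 0 ≤ u q) (a : A) :
    ∑ o, P.W top (push (P.del a o) (fun q => u q * P.tt q a o)) ≤ P.W top u := by
  have h := P.val_super top htop (fun q => ENNReal.ofReal (u q))
    (ENNReal.sum_ne_top.2 fun _ _ => ENNReal.ofReal_ne_top) a
  have e : ∀ o, P.upd (fun q => ENNReal.ofReal (u q)) a o =
      fun x => ENNReal.ofReal (push (P.del a o) (fun q => u q * P.tt q a o) x) := by
    intro o
    funext x
    unfold upd push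
    rw [ENNReal.ofReal_sum_of_nonneg]
    · refine Finset.sum_congr rfl fun q _ => ?_
      rw [P.tr_eq hP]
      split_ifs
      · rw [ENNReal.ofReal_mul (hu q), tt, ENNReal.ofReal_toReal (P.trO_ne_top q a o)]
      · simp
    · intro q _
      split_ifs
      · exact mul_nonneg (hu q) (P.tt_nonneg q a o)
      · exact le_rfl
  simp only [e] at h
  unfold W
  rw [← ENNReal.toReal_sum fun o _ => P.val_ofReal_ne_top top _]
  exact ENNReal.toReal_mono (P.val_ofReal_ne_top top u) h

theorem W_step (hP : P.PostDet) (top : Q) (htop : P.Absorbing top) (u : Q → ℝ)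
    (hu : ∀ q, 0 ≤ u q) (h : List (A × O)) (a : A) :
    ∑ o, P.W top (push (P.dstar (h ++ [(a, o)])) (fun q => u q * P.tt (P.dstar h q) a o)) ≤
      P.W top (push (P.dstar h) u) := by
  have := W_super hP top htop (push (P.dstar h) u) (push_nonneg _ u hu) a
  simp only [push_push] at this
  have e : ∀ o, P.dstar (h ++ [(a, o)]) = fun q => P.del a o (P.dstar h q) := by
    intro o
    funext q
    rw [dstar_append]
    rfl
  simpa only [e] using this

theorem tt_zero_of_bad (hP : P.PostDet) (f : SEC P) (S : Finset Q) (hS : S ∈ f.dom)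
    (h : List (A × O)) (hg : Good f S h) (a : A) (o : O)
    (hb : ¬ (P.stepSet (P.stepSetStar S h) a o).Nonempty) (q : Q) (hq : q ∈ S) :
    P.tt (P.dstar h q) a o = 0 := by
  rw [Finset.not_nonempty_iff_eq_empty, P.stepSet_eq hP, Finset.image_eq_empty,
    Finset.filter_eq_empty_iff] at hb
  have : P.dstar h q ∈ P.stepSetStar S h := by
    rw [(good_spec hP f h S hS hg).2.1]
    exact Finset.mem_image_of_mem _ hq
  have := hb this
  rw [not_not] at this
  simp [tt, this]

theorem tt_pos_of_good (hP : P.PostDet) (f : SEC P) (S : Finset Q) (hS : S ∈ f.dom)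
    (h : List (A × O)) (hg : Good f S h) (a : A) (ha : a ∈ f.act (P.stepSetStar S h)) (o : O)
    (hb : (P.stepSet (P.stepSetStar S h) a o).Nonempty) (q : Q) (hq : q ∈ S) :
    0 < P.tt (P.dstar h q) a o := by
  obtain ⟨h1, h2, -, -⟩ := good_spec hP f h S hS hg
  refine P.tt_pos _ _ _ ((step_facts hP f _ h1 a ha o hb).1 _ ?_)
  rw [h2]
  exact Finset.mem_image_of_mem _ hq

theorem W_class_le (hP : P.PostDet) (top : Q) (htop : P.Absorbing top) (f : SEC P)
    (S : Finset Q) (hS : S ∈ f.dom) (u : Q → ℝ) (hu : ∀ q, 0 ≤ u q) (r : Q) (hr : r ∈ S)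
    (hsupp : ∀ q, u q ≠ 0 → q ∈ S ∧ Indist P f S r q) (h : List (A × O)) (hg : Good f S h) :
    P.W top u ≤ P.W top (push (P.dstar h) u) := by
  obtain ⟨π, ⟨h1, hg1, hπ⟩, hmin⟩ := Set.exists_min_image
    {π : Q → Q | ∃ h, Good f S h ∧ P.dstar h = π} (fun π => P.W top (push π u))
    (Set.toFinite _) ⟨_, [], good_nil f S hS, rfl⟩
  subst hπ
  have hmin' : ∀ h, Good f S h →
      P.W top (push (P.dstar h1) u) ≤ P.W top (push (P.dstar h) u) :=
    fun h hg => hmin _ ⟨h, hg, rfl⟩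
  set m := P.W top (push (P.dstar h1) u) with hm
  obtain ⟨k, k1, k2, k3⟩ := good_return hP f S hS h1 hg1
  have key := good_ext_induct hP f S hS (fun h => P.W top (push (P.dstar h) u) = m) h1 hg1 rfl
    (by
      intro h hg heq a ha o0 hne
      have hstep := W_step hP top htop u hu h a
      have e : ∀ o, P.W top (push (P.dstar (h ++ [(a, o)]))
          (fun q => u q * P.tt (P.dstar h q) a o)) =
          P.tt (P.dstar h r) a o * P.W top (push (P.dstar (h ++ [(a, o)])) u) := by
        intro o
        rw [← W_smul _ _ _ _ (P.tt_nonneg _ _ _), ← push_smul]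
        congr 1
        apply push_congr
        intro q
        by_cases hq : u q = 0
        · simp [hq]
        · obtain ⟨hqS, hi⟩ := hsupp q hq
          rw [indist_iff hP f S hS _ _ hr hqS] at hi
          rw [mul_comm]
          unfold tt
          rw [hi h hg a ha o]
      simp only [e] at hstep
      rw [heq] at hstep
      have hz : ∑ o, P.tt (P.dstar h r) a o *
          (P.W top (push (P.dstar (h ++ [(a, o)])) u) - m) ≤ 0 := by
        simp only [mul_sub, Finset.sum_sub_distrib, ← Finset.sum_mul, P.sum_tt, one_mul]
        linarith
      have hnn : ∀ o ∈ Finset.univ, 0 ≤ P.tt (P.dstar h r) a o *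
          (P.W top (push (P.dstar (h ++ [(a, o)])) u) - m) := by
        intro o _
        by_cases hb : (P.stepSet (P.stepSetStar S h) a o).Nonempty
        · exact mul_nonneg (P.tt_nonneg _ _ _)
            (sub_nonneg.2 (hmin' _ (good_snoc hP f S hS h hg a ha o hb)))
        · rw [tt_zero_of_bad hP f S hS h hg a o hb r hr, zero_mul]
      have h0 := (Finset.sum_eq_zero_iff_of_nonneg hnn).1 (le_antisymm hz (Finset.sum_nonneg hnn))
        o0 (Finset.mem_univ _)
      have hpos := tt_pos_of_good hP f S hS h hg a ha o0 hne r hr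
      rcases mul_eq_zero.1 h0 with h0 | h0
      · exact absurd h0 hpos.ne'
      · linarith) k k1
  have hid : push (P.dstar (h1 ++ k)) u = u :=
    push_eq_self _ _ fun q hq => k3 q (hsupp q hq).1
  simp only [hid] at key
  rw [key]
  exact hmin' h hg

/-- n-step averaged Bhattacharyya coefficient of two states under the uniform strategy of `f` -/
noncomputable def bh (f : SEC P) : ℕ → Finset Q → Q → Q → ℝ
  | 0, _, _, _ => 1
  | n + 1, S, x, y => (∑ a ∈ f.act S, ∑ o, √(P.tt x a o * P.tt y a o) *
      bh f n (P.stepSet S a o) (P.del a o x) (P.del a o y)) / (f.act S).card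

theorem bh_nonneg (f : SEC P) (n : ℕ) : ∀ S x y, 0 ≤ bh f n S x y := by
  induction n with
  | zero => intro S x y; simp [bh]
  | succ n ih =>
    intro S x y
    unfold bh
    exact div_nonneg (Finset.sum_nonneg fun a _ => Finset.sum_nonneg fun o _ =>
      mul_nonneg (Real.sqrt_nonneg _) (ih _ _ _)) (Nat.cast_nonneg _)

theorem sqrt_mul_le_half (x y : ℝ) (hx : 0 ≤ x) (hy : 0 ≤ y) : √(x * y) ≤ (x + y) / 2 := by
  rw [Real.sqrt_le_left (by positivity)]
  nlinarith [sq_nonneg (x - y)]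

theorem sum_sqrt_le_one (x y : Q) (a : A) : ∑ o, √(P.tt x a o * P.tt y a o) ≤ 1 := by
  calc _ ≤ ∑ o, (P.tt x a o + P.tt y a o) / 2 :=
        Finset.sum_le_sum fun o _ => sqrt_mul_le_half _ _ (P.tt_nonneg _ _ _) (P.tt_nonneg _ _ _)
    _ = 1 := by
        rw [← Finset.sum_div, Finset.sum_add_distrib, P.sum_tt, P.sum_tt]
        norm_num

theorem bh_succ_le (f : SEC P) (n : ℕ) : ∀ S x y, bh f (n + 1) S x y ≤ bh f n S x y := by
  induction n with
  | zero =>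
    intro S x y
    simp only [bh, mul_one]
    refine div_le_one_of_le₀ ?_ (Nat.cast_nonneg _)
    calc _ ≤ ∑ a ∈ f.act S, (1 : ℝ) := Finset.sum_le_sum fun a _ => sum_sqrt_le_one x y a
      _ = _ := by simp
  | succ n ih =>
    intro S x y
    rw [bh]
    conv_rhs => rw [bh]
    refine div_le_div_of_nonneg_right ?_ (Nat.cast_nonneg _)
    exact Finset.sum_le_sum fun a _ => Finset.sum_le_sum fun o _ =>
      mul_le_mul_of_nonneg_left (ih _ _ _) (Real.sqrt_nonneg _)

/-- limit of `bh` -/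
noncomputable def bhLim (f : SEC P) (S : Finset Q) (x y : Q) : ℝ := ⨅ n, bh f n S x y

theorem bh_tendsto (f : SEC P) (S : Finset Q) (x y : Q) :
    Tendsto (fun n => bh f n S x y) atTop (𝓝 (bhLim f S x y)) :=
  tendsto_atTop_ciInf (antitone_nat_of_succ_le fun n => bh_succ_le f n S x y)
    ⟨0, by rintro _ ⟨n, rfl⟩; exact bh_nonneg f n S x y⟩

theorem bhLim_nonneg (f : SEC P) (S : Finset Q) (x y : Q) : 0 ≤ bhLim f S x y :=
  le_ciInf fun n => bh_nonneg f n S x y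

theorem bhLim_rec (f : SEC P) (S : Finset Q) (x y : Q) :
    bhLim f S x y = (∑ a ∈ f.act S, ∑ o, √(P.tt x a o * P.tt y a o) *
      bhLim f (P.stepSet S a o) (P.del a o x) (P.del a o y)) / (f.act S).card := by
  refine tendsto_nhds_unique ((tendsto_add_atTop_iff_nat 1).2 (bh_tendsto f S x y)) ?_
  simp only [bh]
  refine Tendsto.div_const ?_ _
  exact tendsto_finsetSum _ fun a _ => tendsto_finsetSum _ fun o _ =>
    (bh_tendsto f _ _ _).const_mul _

theorem bhLim_eq_zero (hP : P.PostDet) (f : SEC P) (S : Finset Q) (hS : S ∈ f.dom) (x y : Q)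
    (hx : x ∈ S) (hy : y ∈ S) (hxy : ¬ Indist P f S x y) : bhLim f S x y = 0 := by
  obtain ⟨π, ⟨h1, hg1, hπ⟩, hmax⟩ := Set.exists_max_image
    {π : Q → Q | ∃ h, Good f S h ∧ P.dstar h = π} (fun π => bhLim f (S.image π) (π x) (π y))
    (Set.toFinite _) ⟨_, [], good_nil f S hS, rfl⟩
  subst hπ
  have himg : ∀ h, Good f S h → S.image (P.dstar h) = P.stepSetStar S h :=
    fun h hg => (good_spec hP f h S hS hg).2.1.symm
  let ψ : List (A × O) → ℝ := fun h => bhLim f (P.stepSetStar S h) (P.dstar h x) (P.dstar h y)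
  have hmax' : ∀ h, Good f S h → ψ h ≤ ψ h1 := by
    intro h hg
    have := hmax _ ⟨h, hg, rfl⟩
    simp only [himg h hg, himg h1 hg1] at this
    exact this
  by_contra hne0
  have hpos : 0 < ψ h1 :=
    lt_of_lt_of_le (lt_of_le_of_ne (bhLim_nonneg f S x y) (Ne.symm hne0))
      (hmax' [] (good_nil f S hS))
  have hone : ∀ h, Good f S h → ψ h = ψ h1 → ∀ a ∈ f.act (P.stepSetStar S h), ∀ o,
      √(P.tt (P.dstar h x) a o * P.tt (P.dstar h y) a o) * ψ (h ++ [(a, o)]) =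
        (P.tt (P.dstar h x) a o + P.tt (P.dstar h y) a o) / 2 * ψ h1 := by
    intro h hg heq
    have hcard : (0 : ℝ) < (f.act (P.stepSetStar S h)).card := by
      exact_mod_cast Finset.card_pos.2 (f.act_nonempty _ (good_spec hP f h S hS hg).1)
    have hrec : ψ h = (∑ a ∈ f.act (P.stepSetStar S h), ∑ o,
        √(P.tt (P.dstar h x) a o * P.tt (P.dstar h y) a o) * ψ (h ++ [(a, o)])) /
          (f.act (P.stepSetStar S h)).card := by
      have := bhLim_rec f (P.stepSetStar S h) (P.dstar h x) (P.dstar h y)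
      simp only [ψ, stepSetStar_append, dstar_append]
      exact this
    rw [heq, eq_div_iff hcard.ne'] at hrec
    have hle : ∀ a ∈ f.act (P.stepSetStar S h), ∀ o ∈ Finset.univ,
        √(P.tt (P.dstar h x) a o * P.tt (P.dstar h y) a o) * ψ (h ++ [(a, o)]) ≤
        (P.tt (P.dstar h x) a o + P.tt (P.dstar h y) a o) / 2 * ψ h1 := by
      intro a ha o _
      by_cases hb : (P.stepSet (P.stepSetStar S h) a o).Nonempty
      · exact mul_le_mul (sqrt_mul_le_half _ _ (P.tt_nonneg _ _ _) (P.tt_nonneg _ _ _))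
          (hmax' _ (good_snoc hP f S hS h hg a ha o hb)) (bhLim_nonneg _ _ _ _)
          (div_nonneg (add_nonneg (P.tt_nonneg _ _ _) (P.tt_nonneg _ _ _)) (by norm_num))
      · simp [tt_zero_of_bad hP f S hS h hg a o hb x hx,
          tt_zero_of_bad hP f S hS h hg a o hb y hy]
    have hsum : ∑ a ∈ f.act (P.stepSetStar S h), ∑ o,
        (P.tt (P.dstar h x) a o + P.tt (P.dstar h y) a o) / 2 * ψ h1 =
        ψ h1 * (f.act (P.stepSetStar S h)).card := by
      have : ∀ a, ∑ o, (P.tt (P.dstar h x) a o + P.tt (P.dstar h y) a o) / 2 * ψ h1 = ψ h1 := by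
        intro a
        rw [← Finset.sum_mul, ← Finset.sum_div, Finset.sum_add_distrib, P.sum_tt, P.sum_tt]
        norm_num
      simp only [this, Finset.sum_const, nsmul_eq_mul]
      ring
    rw [← hsum] at hrec
    have e1 := (Finset.sum_eq_sum_iff_of_le
      (fun a ha => Finset.sum_le_sum (hle a ha))).1 hrec.symm
    intro a ha o
    exact (Finset.sum_eq_sum_iff_of_le (hle a ha)).1 (e1 a ha) o (Finset.mem_univ o)
  have htt : ∀ h, Good f S h → ψ h = ψ h1 → ∀ a ∈ f.act (P.stepSetStar S h), ∀ o,
      P.tt (P.dstar h x) a o = P.tt (P.dstar h y) a o ∧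
      ((P.stepSet (P.stepSetStar S h) a o).Nonempty → ψ (h ++ [(a, o)]) = ψ h1) := by
    intro h hg heq a ha o
    have e := hone h hg heq a ha o
    by_cases hb : (P.stepSet (P.stepSetStar S h) a o).Nonempty
    · have px := tt_pos_of_good hP f S hS h hg a ha o hb x hx
      have py := tt_pos_of_good hP f S hS h hg a ha o hb y hy
      have hm := hmax' _ (good_snoc hP f S hS h hg a ha o hb)
      have hs := sqrt_mul_le_half _ _ px.le py.le
      have hsp : 0 < √(P.tt (P.dstar h x) a o * P.tt (P.dstar h y) a o) :=
        Real.sqrt_pos.2 (mul_pos px py)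
      have hsq := Real.sq_sqrt (mul_pos px py).le
      generalize √(P.tt (P.dstar h x) a o * P.tt (P.dstar h y) a o) = s at *
      generalize P.tt (P.dstar h x) a o = p at *
      generalize P.tt (P.dstar h y) a o = q at *
      have e2 : s = (p + q) / 2 := by
        refine le_antisymm hs ?_
        by_contra hc
        push Not at hc
        nlinarith
      constructor
      · have : (p - q) ^ 2 = 0 := by rw [e2] at hsq; nlinarith
        have := pow_eq_zero_iff (two_ne_zero) |>.1 this
        linarith
      · intro _
        rw [← e2] at e
        exact mul_left_cancel₀ hsp.ne' e
    · exact ⟨by rw [tt_zero_of_bad hP f S hS h hg a o hb x hx,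
          tt_zero_of_bad hP f S hS h hg a o hb y hy], fun h => absurd h hb⟩
  have hall : ∀ k, Good f (P.stepSetStar S h1) k → ψ (h1 ++ k) = ψ h1 :=
    good_ext_induct hP f S hS (fun h => ψ h = ψ h1) h1 hg1 rfl
      fun h hg heq a ha o hb => (htt h hg heq a ha o).2 hb
  obtain ⟨k, k1, k2, k3⟩ := good_return hP f S hS h1 hg1
  apply hxy
  rw [indist_iff hP f S hS x y hx hy]
  intro h hg a ha o
  have gk : Good f (P.stepSetStar S h1) (k ++ h) :=
    good_append f _ k h k1 (by rw [← stepSetStar_append, k2]; exact hg)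
  have e := hall _ gk
  have e2 := (htt _ (good_append f S h1 _ hg1 gk) e a (by
    rw [← List.append_assoc, stepSetStar_append, k2]; exact ha) o).1
  rw [← List.append_assoc, dstar_append _ (h1 ++ k), dstar_append _ (h1 ++ k), k3 x hx, k3 y hy] at e2
  exact (ENNReal.toReal_eq_toReal_iff' (P.trO_ne_top _ _ _) (P.trO_ne_top _ _ _)).1 e2

end POMDP

namespace POMDP

variable {Q A O : Type} [Fintype Q] [Fintype A] [Fintype O] {P : POMDP Q A O}

theorem main_induct (hP : P.PostDet) (top : Q) (htop : P.Absorbing top) (f : SEC P)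
    (S : Finset Q) (hS : S ∈ f.dom) (b : Q → ℝ) (hb0 : ∀ q, 0 ≤ b q) (hb1 : ∑ q, b q ≤ 1)
    (hbS : ∀ q, b q ≠ 0 → q ∈ S) (r : Finset Q → Q)
    (hr : ∀ C ∈ S.image (classOf P f S), r C ∈ S ∧ classOf P f S (r C) = C) (n : ℕ) :
    ∀ h, Good f S h → ∀ w : Finset Q → ℝ, (∀ C, 0 ≤ w C) →
    ∑ C ∈ S.image (classOf P f S),
        w C * P.W top (fun q => if classOf P f S q = C then b q else 0) ≤
      P.W top (push (P.dstar h) (fun q => w (classOf P f S q) * b q)) +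
      ∑ C ∈ S.image (classOf P f S), ∑ C' ∈ (S.image (classOf P f S)).erase C,
        bh f n (P.stepSetStar S h) (P.dstar h (r C)) (P.dstar h (r C')) * √(w C * w C') := by
  set cl := S.image (classOf P f S) with hcl
  set v : Finset Q → ℝ := fun C => P.W top (fun q => if classOf P f S q = C then b q else 0)
    with hv
  have hv0 : ∀ C, 0 ≤ v C := fun C => P.W_nonneg top _
  have hite0 : ∀ C q, 0 ≤ (if classOf P f S q = C then b q else 0) := by
    intro C q
    split_ifs
    · exact hb0 q
    · exact le_rfl
  have hv1 : ∀ C, v C ≤ 1 := by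
    intro C
    refine (P.W_le top _ (hite0 C)).trans (le_trans (Finset.sum_le_sum fun q _ => ?_) hb1)
    split_ifs
    · exact le_rfl
    · exact hb0 q
  have hmem : ∀ q ∈ S, classOf P f S q ∈ cl := fun q hq => Finset.mem_image_of_mem _ hq
  have hind : ∀ q ∈ S, Indist P f S (r (classOf P f S q)) q := by
    intro q hq
    obtain ⟨h1, h2⟩ := hr _ (hmem q hq)
    exact (classOf_eq_iff hP f S hS _ _ h1 hq).1 h2
  induction n with
  | zero =>
    intro h hg w hw
    have hclne : cl.Nonempty := (f.dom_nonempty S hS).image _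
    obtain ⟨D, hD, hmax⟩ := Finset.exists_max_image cl (fun C => w C * v C) hclne
    have h1 : w D * v D ≤ P.W top (push (P.dstar h) (fun q => w (classOf P f S q) * b q)) := by
      have hcls := W_class_le hP top htop f S hS
        (fun q => if classOf P f S q = D then b q else 0) (hite0 D) (r D) (hr D hD).1
        (by
          intro q hq
          have hqD : classOf P f S q = D := by
            by_contra hc
            simp [hc] at hq
          simp only [hqD, if_true] at hq
          refine ⟨hbS q hq, ?_⟩
          rw [← hqD]
          exact hind q (hbS q hq)) h hg
      refine (mul_le_mul_of_nonneg_left hcls (hw D)).trans ?_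
      rw [← W_smul _ _ _ _ (hw D), ← push_smul]
      refine P.W_mono top _ _ (push_mono _ _ _ fun q => ?_)
      split_ifs with hq
      · rw [hq]
      · rw [mul_zero]
        exact mul_nonneg (hw _) (hb0 q)
    rw [← Finset.add_sum_erase cl _ hD]
    refine add_le_add h1 ?_
    refine le_trans ?_ (Finset.single_le_sum (f := fun C => ∑ C' ∈ cl.erase C,
        bh f 0 (P.stepSetStar S h) (P.dstar h (r C)) (P.dstar h (r C')) * √(w C * w C'))
      (fun C _ => Finset.sum_nonneg fun C' _ =>
        mul_nonneg (bh_nonneg f _ _ _ _) (Real.sqrt_nonneg _)) hD)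
    refine Finset.sum_le_sum fun C hC => ?_
    have hm := hmax C (Finset.mem_of_mem_erase hC)
    simp only [bh, one_mul]
    refine Real.le_sqrt_of_sq_le ?_
    have h2 : w C * v C ≤ w C := mul_le_of_le_one_right (hw C) (hv1 C)
    have h3 : w C * v C ≤ w D := hm.trans (mul_le_of_le_one_right (hw D) (hv1 D))
    have h4 : 0 ≤ w C * v C := mul_nonneg (hw C) (hv0 C)
    rw [sq]
    exact mul_le_mul h3 h2 h4 (hw D)
  | succ n ih =>
    intro h hg w hw
    set Sh := P.stepSetStar S h with hSh
    have hcard : (0 : ℝ) < (f.act Sh).card := by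
      exact_mod_cast Finset.card_pos.2 (f.act_nonempty _ (good_spec hP f h S hS hg).1)
    have hstep : ∀ a ∈ f.act Sh, ∑ C ∈ cl, w C * v C ≤
        P.W top (push (P.dstar h) (fun q => w (classOf P f S q) * b q)) +
        ∑ C ∈ cl, ∑ C' ∈ cl.erase C, (∑ o,
          √(P.tt (P.dstar h (r C)) a o * P.tt (P.dstar h (r C')) a o) *
          bh f n (P.stepSet Sh a o) (P.del a o (P.dstar h (r C)))
            (P.del a o (P.dstar h (r C')))) * √(w C * w C') := by
      intro a ha
      have hw' : ∀ o C, 0 ≤ w C * P.tt (P.dstar h (r C)) a o :=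
        fun o C => mul_nonneg (hw C) (P.tt_nonneg _ _ _)
      have hIH : ∀ o, ∑ C ∈ cl, (w C * P.tt (P.dstar h (r C)) a o) * v C ≤
          P.W top (push (P.dstar (h ++ [(a, o)]))
            (fun q => (w (classOf P f S q) * b q) * P.tt (P.dstar h q) a o)) +
          ∑ C ∈ cl, ∑ C' ∈ cl.erase C,
            (√(P.tt (P.dstar h (r C)) a o * P.tt (P.dstar h (r C')) a o) *
            bh f n (P.stepSet Sh a o) (P.del a o (P.dstar h (r C)))
              (P.del a o (P.dstar h (r C')))) * √(w C * w C') := by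
        intro o
        by_cases hb : (P.stepSet Sh a o).Nonempty
        · have := ih (h ++ [(a, o)]) (good_snoc hP f S hS h hg a ha o hb)
            (fun C => w C * P.tt (P.dstar h (r C)) a o) (hw' o)
          refine this.trans (add_le_add (le_of_eq ?_) (le_of_eq ?_))
          · congr 1
            apply push_congr
            intro q
            by_cases hq : b q = 0
            · simp [hq]
            · have hqS := hbS q hq
              have hi := hind q hqS
              rw [indist_iff hP f S hS _ _ (hr _ (hmem q hqS)).1 hqS] at hi
              unfold tt
              rw [hi h hg a ha o]
              ring
          · refine Finset.sum_congr rfl fun C _ => Finset.sum_congr rfl fun C' _ => ?_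
            rw [stepSetStar_append, dstar_append, dstar_append]
            have : √(w C * P.tt (P.dstar h (r C)) a o * (w C' * P.tt (P.dstar h (r C')) a o)) =
                √(P.tt (P.dstar h (r C)) a o * P.tt (P.dstar h (r C')) a o) * √(w C * w C') := by
              rw [← Real.sqrt_mul (mul_nonneg (P.tt_nonneg _ _ _) (P.tt_nonneg _ _ _))]
              congr 1
              ring
            rw [this]
            simp only [stepSetStar, dstar]
            rw [← hSh]
            ring
        · have hz : ∑ C ∈ cl, (w C * P.tt (P.dstar h (r C)) a o) * v C = 0 := by
            refine Finset.sum_eq_zero fun C hC => ?_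
            rw [tt_zero_of_bad hP f S hS h hg a o hb _ (hr C hC).1]
            ring
          rw [hz]
          exact add_nonneg (P.W_nonneg top _) (Finset.sum_nonneg fun C _ =>
            Finset.sum_nonneg fun C' _ => mul_nonneg (mul_nonneg (Real.sqrt_nonneg _)
              (bh_nonneg f _ _ _ _)) (Real.sqrt_nonneg _))
      have hsum := Finset.sum_le_sum fun o (_ : o ∈ (Finset.univ : Finset O)) => hIH o
      rw [Finset.sum_add_distrib] at hsum
      have hl : ∑ o, ∑ C ∈ cl, (w C * P.tt (P.dstar h (r C)) a o) * v C =
          ∑ C ∈ cl, w C * v C := by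
        rw [Finset.sum_comm]
        refine Finset.sum_congr rfl fun C _ => ?_
        rw [← Finset.sum_mul, ← Finset.mul_sum, P.sum_tt, mul_one]
      rw [hl] at hsum
      refine hsum.trans (add_le_add (W_step hP top htop _
        (fun q => mul_nonneg (hw _) (hb0 q)) h a) (le_of_eq ?_))
      rw [Finset.sum_comm]
      refine Finset.sum_congr rfl fun C _ => ?_
      rw [Finset.sum_comm]
      refine Finset.sum_congr rfl fun C' _ => ?_
      rw [Finset.sum_mul]
    have havg := Finset.sum_le_sum hstep
    rw [Finset.sum_add_distrib, Finset.sum_const, Finset.sum_const, nsmul_eq_mul,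
      nsmul_eq_mul] at havg
    refine le_of_mul_le_mul_left (havg.trans (le_of_eq ?_)) hcard
    rw [mul_add]
    congr 1
    rw [Finset.sum_comm, Finset.mul_sum]
    refine Finset.sum_congr rfl fun C _ => ?_
    rw [Finset.sum_comm, Finset.mul_sum]
    refine Finset.sum_congr rfl fun C' _ => ?_
    rw [← Finset.sum_mul, bh, ← mul_assoc, mul_div_cancel₀ _ hcard.ne']

theorem main_real (hP : P.PostDet) (top : Q) (htop : P.Absorbing top) (f : SEC P)
    (S : Finset Q) (hS : S ∈ f.dom) (b : Q → ℝ) (hb0 : ∀ q, 0 ≤ b q) (hb1 : ∑ q, b q ≤ 1)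
    (hbS : ∀ q, b q ≠ 0 → q ∈ S) :
    ∑ C ∈ S.image (classOf P f S),
        P.W top (fun q => if classOf P f S q = C then b q else 0) ≤ P.W top b := by
  obtain ⟨q0, -⟩ := f.dom_nonempty S hS
  have hex : ∀ C, ∃ q, C ∈ S.image (classOf P f S) → q ∈ S ∧ classOf P f S q = C := by
    intro C
    by_cases hC : C ∈ S.image (classOf P f S)
    · obtain ⟨q, hq⟩ := Finset.mem_image.1 hC
      exact ⟨q, fun _ => hq⟩
    · exact ⟨q0, fun h => absurd h hC⟩
  choose r hr using hex
  have hmain := fun n => main_induct hP top htop f S hS b hb0 hb1 hbS r hr n [] (good_nil f S hS)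
    (fun _ => 1) (fun _ => zero_le_one)
  simp only [one_mul, mul_one, Real.sqrt_one] at hmain
  have hid : push (P.dstar []) b = b := push_eq_self _ _ fun q _ => rfl
  rw [show (fun q => b q) = b from rfl, hid] at hmain
  have hlim : Tendsto (fun n => P.W top b + ∑ C ∈ S.image (classOf P f S),
      ∑ C' ∈ (S.image (classOf P f S)).erase C,
        bh f n (P.stepSetStar S []) (P.dstar [] (r C)) (P.dstar [] (r C'))) atTop
      (𝓝 (P.W top b + ∑ C ∈ S.image (classOf P f S),
      ∑ C' ∈ (S.image (classOf P f S)).erase C, (0 : ℝ))) := by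
    refine Tendsto.const_add _ ?_
    refine tendsto_finsetSum _ fun C hC => tendsto_finsetSum _ fun C' hC' => ?_
    obtain ⟨hne, hC'⟩ := Finset.mem_erase.1 hC'
    have h0 := bhLim_eq_zero hP f S hS (r C) (r C') (hr C hC).1 (hr C' hC').1 (by
      intro hi
      apply hne
      rw [← (hr C hC).2, ← (hr C' hC').2]
      exact ((classOf_eq_iff hP f S hS _ _ (hr C hC).1 (hr C' hC').1).2 hi).symm)
    have := bh_tendsto f S (r C) (r C')
    rw [h0] at this
    exact this
  have := ge_of_tendsto' hlim hmain
  simpa using this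

theorem val_class_sum (hP : P.PostDet) (top : Q) (htop : P.Absorbing top) (f : SEC P)
    (b : Q → ℝ≥0∞) (hb : (∑ q : Q, b q) ≤ 1) (hS : beliefSupp b ∈ f.dom) :
    P.val {top} b =
      ∑ C ∈ (beliefSupp b).image (fun q => POMDP.classOf P f (beliefSupp b) q),
        P.val {top} (restrictBel b C) := by
  set S := beliefSupp b with hSdef
  have hbfin : ∀ q, b q ≠ ⊤ := by
    intro q
    refine ne_top_of_le_ne_top ENNReal.one_ne_top (le_trans ?_ hb)
    exact Finset.single_le_sum (f := b) (fun _ _ => zero_le) (Finset.mem_univ q)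
  have hmemS : ∀ q, q ∈ S ↔ b q ≠ 0 := by
    intro q
    simp [hSdef, beliefSupp]
  have hrestr : ∀ C ∈ S.image (fun q => classOf P f S q), ∀ q,
      restrictBel b C q = if classOf P f S q = C then b q else 0 := by
    intro C hC q
    obtain ⟨c, hc, rfl⟩ := Finset.mem_image.1 hC
    unfold restrictBel
    by_cases hq : b q = 0
    · simp [hq]
    · have hqS := (hmemS q).2 hq
      have : q ∈ classOf P f S c ↔ classOf P f S q = classOf P f S c := by
        rw [eq_comm, classOf_eq_iff hP f S hS _ _ hc hqS]
        simp [classOf, hqS]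
      simp only [this]
  apply le_antisymm
  · refine iSup_le fun σ => ?_
    refine le_trans ?_ (Finset.sum_le_sum fun C _ => le_iSup _ σ)
    simp only [reachProb_eq]
    rw [Finset.sum_comm]
    refine Finset.sum_le_sum fun q _ => ?_
    rw [← Finset.sum_mul]
    refine mul_le_mul_left ?_ _
    by_cases hq : b q = 0
    · simp [hq]
    · have hqS := (hmemS q).2 hq
      have hC : classOf P f S q ∈ S.image (fun q => classOf P f S q) :=
        Finset.mem_image_of_mem _ hqS
      refine le_trans (le_of_eq ?_) (Finset.single_le_sum (f := fun C => restrictBel b C q)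
        (fun _ _ => zero_le) hC)
      simp only [hrestr _ hC, if_true]
  · have hsum1 : ∑ q, (b q).toReal ≤ 1 := by
      rw [← ENNReal.toReal_sum fun q _ => hbfin q]
      exact ENNReal.toReal_le_of_le_ofReal zero_le_one (by simpa using hb)
    have hm := main_real hP top htop f S hS (fun q => (b q).toReal)
      (fun q => ENNReal.toReal_nonneg) hsum1 (by
        intro q hq
        rw [hmemS]
        intro h0
        simp [h0] at hq)
    unfold W at hm
    rw [← ENNReal.toReal_sum fun C _ => P.val_ofReal_ne_top top _] at hm
    rw [ENNReal.toReal_le_toReal (ENNReal.sum_ne_top.2 fun C _ => P.val_ofReal_ne_top top _)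
      (P.val_ofReal_ne_top top _)] at hm
    have e1 : (fun q => ENNReal.ofReal (b q).toReal) = b := by
      funext q
      exact ENNReal.ofReal_toReal (hbfin q)
    rw [e1] at hm
    refine le_trans (le_of_eq ?_) hm
    refine Finset.sum_congr rfl fun C hC => ?_
    congr 1
    funext q
    rw [hrestr C hC]
    split_ifs
    · exact (ENNReal.ofReal_toReal (hbfin q)).symm
    · simp

end POMDP

/-- In a posterior-deterministic POMDP (with unique absorbing
observable target state `⊤` and unique absorbing observable value-`0` state `⊥`),
if the support of a sub-belief `b` belongs to the domain of a distinguishing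
maximal SEC `f`, then `Val(b) = Σ_{C ∈ S/≡_{(f,S)}} Val(b|_C)`. -/
theorem stmt3 {Q A O : Type} [Fintype Q] [Fintype A] [Fintype O] [Nonempty A]
    (P : POMDP Q A O) (hP : P.PostDet)
    (top bot : Q) (hne : top ≠ bot)
    (htopAbs : P.Absorbing top) (htopObs : P.Observable top)
    (hbotAbs : P.Absorbing bot) (hbotObs : P.Observable bot)
    (hbot0 : ∀ q : Q, P.val {top} (dirac q) = 0 ↔ q = bot)
    (f : POMDP.SEC P) (hmax : f.Maximal) (hdist : f.Distinguishing)
    (b : Q → ℝ≥0∞) (hb : (∑ q : Q, b q) ≤ 1) (hS : beliefSupp b ∈ f.dom) :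
    P.val {top} b =
      ∑ C ∈ (beliefSupp b).image (fun q => POMDP.classOf P f (beliefSupp b) q),
        P.val {top} (restrictBel b C) := by
  exact POMDP.val_class_sum hP top htopAbs f b hb hS
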